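/- Let h be a complete Bernstein function and ζ ∈ ℂ with Im ζ > 0. Then there exists a Stieltjes function g with both constants b and c in its Stieltjes representation equal to zero, such that for all ξ ∈ ℂ ∖ ((−∞, 0] ∪ {ζ, conj(ζ)}): h(ξ)/((ξ − ζ)(ξ − conj(ζ))) = (1/(2i·Im ζ))·( h(ζ)/(ξ − ζ) − h(conj(ζ))/(ξ − conj(ζ)) ) − g(ξ). -/

import Mathlib

open MeasureTheory

/-- A complete Bernstein function (equivalent characterisation): holomorphic on
`ℂ ∖ (−∞, 0]`, nonnegative on `(0, ∞)`, and with `Im f(ξ) ≥ 0` on the upper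
half-plane. -/
def IsCBF (f : ℂ → ℂ) : Prop :=
  DifferentiableOn ℂ f {ξ : ℂ | 0 < ξ.re ∨ ξ.im ≠ 0} ∧
  (∀ x : ℝ, 0 < x → (f x).im = 0 ∧ 0 ≤ (f x).re) ∧
  (∀ ξ : ℂ, 0 < ξ.im → 0 ≤ (f ξ).im)

open Filter Topology Metric in
/-- The **Herglotz representation** of a holomorphic function with nonnegative real part on the unit
disc; the measure vanishes on the arcs across which the function is continuous with vanishing real
part. -/
theorem exists_finiteMeasure_re_eq_integral_herglotzRieszKernel {f : ℂ → ℂ}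
    (hf : DifferentiableOn ℂ f (ball 0 1)) (hre : ∀ w ∈ ball (0 : ℂ) 1, 0 ≤ (f w).re) :
    ∃ μ : FiniteMeasure ℝ,
      (∀ w ∈ ball (0 : ℂ) 1,
        (f w).re = ∫ θ, (herglotzRieszKernel 0 w (circleMap 0 1 θ)).re ∂(μ : Measure ℝ)) ∧
      ∀ V : Set ℝ, IsOpen V →
        (∀ θ ∈ V, ContinuousAt f (circleMap 0 1 θ) ∧ (f (circleMap 0 1 θ)).re = 0) →
        (μ : Measure ℝ) V = 0 := by
  obtain ⟨r, -, hr, hr_lim⟩ := exists_seq_strictMono_tendsto' (zero_lt_one' ℝ)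
  have hmem (n : ℕ) (θ : ℝ) : circleMap 0 (r n) θ ∈ ball (0 : ℂ) 1 := by
    simpa [abs_of_pos (hr n).1] using (hr n).2
  have hcirc (n : ℕ) (θ : ℝ) : (r n : ℂ) * circleMap 0 1 θ = circleMap 0 (r n) θ := by
    simp [circleMap]
  set u : ℕ → ℝ → ℝ := fun n θ ↦ (2 * Real.pi)⁻¹ * (f (circleMap 0 (r n) θ)).re with hu
  have hu_nonneg (n : ℕ) (θ : ℝ) : 0 ≤ u n θ :=
    mul_nonneg (by positivity) (hre _ (hmem n θ))
  have hu_cont (n : ℕ) : Continuous (u n) :=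
    continuous_const.mul <| Complex.continuous_re.comp <|
      hf.continuousOn.comp_continuous (continuous_circleMap _ _) (hmem n)
  set vol : Measure ℝ := volume.restrict (Set.Ioc 0 (2 * Real.pi)) with hvol
  have hu_int (n : ℕ) : Integrable (u n) vol :=
    ((hu_cont n).integrableOn_Icc).mono_set Set.Ioc_subset_Icc_self
  set m : ℕ → Measure ℝ := fun n ↦ vol.withDensity (fun θ ↦ ENNReal.ofReal (u n θ)) with hm
  have hm_int (n : ℕ) (g : ℝ → ℝ) : ∫ θ, g θ ∂(m n) = ∫ θ, u n θ * g θ ∂vol := by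
    rw [hm, integral_withDensity_eq_integral_toReal_smul (by fun_prop) (by simp)]
    simp [ENNReal.toReal_ofReal (hu_nonneg n _)]
  have hpoisson (n : ℕ) (w : ℂ) (hw : w ∈ ball (0 : ℂ) 1) :
      ∫ θ, (herglotzRieszKernel 0 w (circleMap 0 1 θ)).re ∂(m n) = (f (r n * w)).re := by
    have hmaps : ∀ z ∈ closedBall (0 : ℂ) 1, (r n : ℂ) * z ∈ ball (0 : ℂ) 1 := by
      intro z hz
      have h1 := (hr n).1
      have h2 := (hr n).2
      simp only [mem_closedBall, mem_ball, dist_zero_right, norm_mul, Complex.norm_real,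
        Real.norm_eq_abs, abs_of_pos h1] at hz ⊢
      nlinarith [norm_nonneg z]
    have hg : DifferentiableOn ℂ (fun z ↦ f (r n * z)) (closedBall 0 1) :=
      hf.comp (by fun_prop) hmaps
    have hg' : DiffContOnCl ℂ (fun z ↦ f (r n * z)) (ball 0 1) :=
      DifferentiableOn.diffContOnCl (by rwa [closure_ball _ one_ne_zero])
    have key := hg'.circleAverage_re_herglotzRieszKernel_smul hw
    have hci : CircleIntegrable (Complex.re ∘ herglotzRieszKernel 0 w • fun z ↦ f (r n * z)) 0 1 := by
      refine ContinuousOn.circleIntegrable zero_le_one ?_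
      refine ContinuousOn.smul ?_ (hg.continuousOn.mono sphere_subset_closedBall)
      refine Complex.continuous_re.comp_continuousOn ?_
      rw [herglotzRieszKernel_fun_def]
      refine ContinuousOn.div (by fun_prop) (by fun_prop) ?_
      intro z hz h0
      simp only [sub_zero, sub_eq_zero] at h0
      simp [← h0] at hw
      simp at hz
      linarith
    rw [← key, ← Complex.reCLM_apply, ← Complex.reCLM.circleAverage_comp_comm hci,
      Real.circleAverage_def, hm_int, hvol, ← intervalIntegral.integral_of_le (by positivity),
      smul_eq_mul, ← intervalIntegral.integral_const_mul]
    refine intervalIntegral.integral_congr fun θ _ ↦ ?_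
    simp [hu, hcirc]
    ring
  have hm_fin (n : ℕ) : IsFiniteMeasure (m n) :=
    isFiniteMeasure_withDensity_ofReal (hu_int n).2
  have hm_mass (n : ℕ) : (m n) Set.univ = ENNReal.ofReal (f 0).re := by
    have h0 := hpoisson n 0 (by simp)
    have h1 : ∀ θ : ℝ, (herglotzRieszKernel 0 0 (circleMap 0 1 θ)).re = 1 := by
      intro θ
      have : circleMap 0 1 θ ≠ 0 := circleMap_ne_center one_ne_zero
      simp [herglotzRieszKernel_def, this]
    simp only [h1, mul_zero, integral_const, smul_eq_mul, mul_one] at h0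
    rw [← h0, ofReal_measureReal]
  set M : ℕ → FiniteMeasure ℝ := fun n ↦ ⟨m n, hm_fin n⟩ with hM
  have hcompact := isCompact_setOfPred_finiteMeasure_le_of_isCompact (E := ℝ)
    (Real.toNNReal (f 0).re) (isCompact_Icc (a := 0) (b := 2 * Real.pi))
  have hM_mem (n : ℕ) : M n ∈ {μ : FiniteMeasure ℝ |
      μ.mass ≤ Real.toNNReal (f 0).re ∧ μ (Set.Icc 0 (2 * Real.pi))ᶜ = 0} := by
    constructor
    · rw [← ENNReal.coe_le_coe, FiniteMeasure.ennreal_mass]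
      exact (hm_mass n).le
    · rw [FiniteMeasure.null_iff_toMeasure_null]
      refine withDensity_absolutelyContinuous _ _ ?_
      rw [hvol, Measure.restrict_apply measurableSet_Icc.compl]
      convert measure_empty (μ := volume)
      ext θ
      simp +contextual [Set.mem_Ioc, le_of_lt]
  obtain ⟨μ, -, hμ⟩ := hcompact.ultrafilter_le_nhds' ((hyperfilter ℕ).map M)
    (Ultrafilter.mem_map.2 (Filter.univ_mem' hM_mem))
  have hlim : Tendsto M (hyperfilter ℕ) (𝓝 μ) := hμ
  rw [FiniteMeasure.tendsto_iff_forall_integral_tendsto] at hlim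
  refine ⟨μ, ?_, ?_⟩
  · intro w hw
    have hne (θ : ℝ) : 1 - ‖w‖ ≤ ‖circleMap 0 1 θ - w‖ := by
      simpa using norm_sub_norm_le (circleMap 0 1 θ) w
    have hw1 : ‖w‖ < 1 := by simpa using hw
    have hcont : Continuous fun θ ↦ (herglotzRieszKernel 0 w (circleMap 0 1 θ)).re := by
      refine Complex.continuous_re.comp ?_
      simp only [herglotzRieszKernel_def, sub_zero]
      refine Continuous.div (by fun_prop) (by fun_prop) fun θ h0 ↦ ?_
      have := hne θ
      rw [h0, norm_zero] at this
      linarith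
    have hbound (θ : ℝ) :
        ‖(herglotzRieszKernel 0 w (circleMap 0 1 θ)).re‖ ≤ 2 / (1 - ‖w‖) := by
      refine (Complex.abs_re_le_norm _).trans ?_
      simp only [herglotzRieszKernel_def, sub_zero, norm_div]
      have h1 : ‖circleMap 0 1 θ + w‖ ≤ 2 := by
        refine (norm_add_le _ _).trans ?_
        simp only [norm_circleMap_zero, abs_one]
        linarith
      have h2 : 0 < 1 - ‖w‖ := by linarith
      gcongr
      exact hne θ
    have h1 := hlim (BoundedContinuousFunction.ofNormedAddCommGroup _ hcont _ hbound)
    have h2 : Tendsto (fun n ↦ (f (r n * w)).re) atTop (𝓝 (f w).re) := by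
      have h3 : ContinuousAt f w := (hf.differentiableAt (isOpen_ball.mem_nhds hw)).continuousAt
      have h4 : Tendsto (fun n ↦ (r n : ℂ) * w) atTop (𝓝 w) := by
        simpa using ((Complex.continuous_ofReal.tendsto 1).comp hr_lim).mul_const w
      exact (Complex.continuous_re.tendsto _).comp (h3.tendsto.comp h4)
    refine tendsto_nhds_unique (h2.mono_left Nat.hyperfilter_le_atTop) ?_
    refine h1.congr fun n ↦ ?_
    exact hpoisson n w hw
  · intro V hV hfV
    refine measure_null_of_locally_null V fun θ₀ hθ₀ ↦ ?_
    obtain ⟨hc, -⟩ := hfV θ₀ hθ₀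
    have hbd : ∀ᶠ p : ℝ × ℝ in 𝓝 1 ×ˢ 𝓝 θ₀,
        ‖f (circleMap 0 p.1 p.2)‖ < ‖f (circleMap 0 1 θ₀)‖ + 1 := by
      have hcm : ContinuousAt (fun p : ℝ × ℝ ↦ circleMap 0 p.1 p.2) (1, θ₀) := by
        unfold circleMap
        fun_prop
      rw [← nhds_prod_eq]
      exact (ContinuousAt.comp (f := fun p : ℝ × ℝ ↦ circleMap 0 p.1 p.2) hc hcm).norm
        (Iio_mem_nhds (lt_add_one _))
    obtain ⟨p₁, hp₁, p₂, hp₂, hp⟩ := eventually_prod_iff.1 hbd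
    obtain ⟨δ, hδ, hball⟩ := Metric.eventually_nhds_iff_ball.1 (hp₂.and (hV.mem_nhds hθ₀))
    set φ : ℝ → ℝ := fun θ ↦ max 0 (δ - |θ - θ₀|) with hφ
    have hφ_nonneg (θ : ℝ) : 0 ≤ φ θ := le_max_left _ _
    have hφ_le (θ : ℝ) : φ θ ≤ δ := max_le hδ.le (by linarith [abs_nonneg (θ - θ₀)])
    have hφ_cont : Continuous φ := by fun_prop
    have hφ_bound (θ : ℝ) : ‖φ θ‖ ≤ δ := by
      rw [Real.norm_of_nonneg (hφ_nonneg θ)]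
      exact hφ_le θ
    have hφ_zero (θ : ℝ) (hθ : θ ∉ ball θ₀ δ) : φ θ = 0 := by
      rw [mem_ball, Real.dist_eq, not_lt] at hθ
      exact max_eq_left (by linarith)
    have h1 := hlim (BoundedContinuousFunction.ofNormedAddCommGroup φ hφ_cont δ hφ_bound)
    have h2 : Tendsto (fun n ↦ ∫ θ, φ θ ∂(m n)) atTop (𝓝 (∫ _, (0 : ℝ) ∂vol)) := by
      simp only [hm_int]
      refine tendsto_integral_filter_of_dominated_convergence
        (fun _ ↦ (2 * Real.pi)⁻¹ * (‖f (circleMap 0 1 θ₀)‖ + 1) * δ) ?_ ?_ ?_ ?_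
      · exact Eventually.of_forall fun n ↦ ((hu_cont n).mul hφ_cont).aestronglyMeasurable
      · filter_upwards [hr_lim.eventually hp₁] with n hn
        refine Eventually.of_forall fun θ ↦ ?_
        by_cases hθ : θ ∈ ball θ₀ δ
        · rw [norm_mul, hu, norm_mul, Real.norm_of_nonneg (by positivity : 0 ≤ (2 * Real.pi)⁻¹)]
          have := hp hn (hball θ hθ).1
          have h5 := (Complex.abs_re_le_norm _).trans this.le
          gcongr
          · exact h5
          · exact hφ_bound θ
        · rw [hφ_zero θ hθ, mul_zero, norm_zero]
          positivity
      · exact integrable_const _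
      · refine Eventually.of_forall fun θ ↦ ?_
        by_cases hθ : θ ∈ ball θ₀ δ
        · obtain ⟨hc', h0⟩ := hfV θ (hball θ hθ).2
          have h4 : Tendsto (fun n ↦ circleMap 0 (r n) θ) atTop (𝓝 (circleMap 0 1 θ)) := by
            have : Continuous fun R : ℝ ↦ circleMap 0 R θ := by
              unfold circleMap
              fun_prop
            exact (this.tendsto 1).comp hr_lim
          have h5 := (Complex.continuous_re.tendsto _).comp (hc'.tendsto.comp h4)
          rw [h0] at h5
          simpa [hu] using (h5.const_mul (2 * Real.pi)⁻¹).mul_const (φ θ)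
        · simp [hφ_zero θ hθ]
    have h3 : ∫ θ, φ θ ∂(μ : Measure ℝ) = 0 := by
      rw [integral_zero] at h2
      exact tendsto_nhds_unique h1 (h2.mono_left Nat.hyperfilter_le_atTop)
    have hφ_int : Integrable φ (μ : Measure ℝ) :=
      Integrable.of_bound hφ_cont.aestronglyMeasurable δ (Eventually.of_forall hφ_bound)
    rw [integral_eq_zero_iff_of_nonneg hφ_nonneg hφ_int] at h3
    refine ⟨ball θ₀ δ, mem_nhdsWithin_of_mem_nhds (ball_mem_nhds _ hδ), ?_⟩
    refine measure_mono_null (fun θ hθ ↦ ?_) (ae_iff.1 h3)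
    rw [mem_ball, Real.dist_eq] at hθ
    exact (lt_of_lt_of_le (by linarith : 0 < δ - |θ - θ₀|) (le_max_right _ _)).ne'

open Metric in
lemma Complex.le_norm_add_ofReal {ξ₀ ξ : ℂ} {δ s : ℝ} (hδ : ball ξ₀ (2 * δ) ⊆ slitPlane)
    (hξ : ξ ∈ ball ξ₀ δ) (hs : 0 ≤ s) : δ ≤ ‖ξ + s‖ := by
  by_contra! hlt
  have hmem : (-s : ℂ) ∈ ball ξ₀ (2 * δ) := by
    rw [mem_ball, dist_eq_norm] at hξ ⊢
    calc ‖-(s : ℂ) - ξ₀‖ = ‖(ξ - ξ₀) - (ξ + s)‖ := by ring_nf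
      _ ≤ ‖ξ - ξ₀‖ + ‖ξ + s‖ := norm_sub_le _ _
      _ < 2 * δ := by linarith
  have := hδ hmem
  rw [mem_slitPlane_iff] at this
  simp at this
  linarith

open Metric Complex Filter Topology in
/-- The Stieltjes transform of a finite measure on `[0, ∞)` is holomorphic on the slit plane. -/
theorem differentiableOn_integral_one_div_add_ofReal {ν : Measure ℝ} [IsFiniteMeasure ν]
    (hν : ν (Set.Iio 0) = 0) :
    DifferentiableOn ℂ (fun ξ : ℂ ↦ ∫ s : ℝ, 1 / (ξ + (s : ℂ)) ∂ν) slitPlane := by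
  intro ξ₀ hξ₀
  obtain ⟨ε, hε, hball⟩ := Metric.isOpen_iff.1 isOpen_slitPlane ξ₀ hξ₀
  set δ := ε / 2 with hδ
  have hδ_pos : 0 < δ := by positivity
  have hball' : ball ξ₀ (2 * δ) ⊆ slitPlane := by rwa [hδ, mul_div_cancel₀ _ two_ne_zero]
  have hae : ∀ᵐ s ∂ν, 0 ≤ s := by
    rw [ae_iff]
    simpa [Set.Iio] using hν
  have hmeas (ξ : ℂ) : AEStronglyMeasurable (fun s : ℝ ↦ 1 / (ξ + (s : ℂ))) ν :=
    Measurable.aestronglyMeasurable (by fun_prop)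
  have hmeas' (ξ : ℂ) : AEStronglyMeasurable (fun s : ℝ ↦ -1 / (ξ + (s : ℂ)) ^ 2) ν :=
    Measurable.aestronglyMeasurable (by fun_prop)
  refine (hasDerivAt_integral_of_dominated_loc_of_deriv_le (s := ball ξ₀ δ)
    (F' := fun ξ s ↦ -1 / (ξ + (s : ℂ)) ^ 2) (bound := fun _ ↦ 1 / δ ^ 2)
    (ball_mem_nhds _ hδ_pos) (Eventually.of_forall hmeas) ?_ (hmeas' ξ₀) ?_
    (integrable_const _) ?_).2.differentiableAt.differentiableWithinAt
  · refine Integrable.of_bound (hmeas ξ₀) (1 / δ) ?_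
    filter_upwards [hae] with s hs
    rw [norm_div, norm_one]
    gcongr
    exact le_norm_add_ofReal hball' (mem_ball_self hδ_pos) hs
  · filter_upwards [hae] with s hs ξ hξ
    rw [norm_div, norm_neg, norm_one, norm_pow]
    gcongr
    exact le_norm_add_ofReal hball' hξ hs
  · filter_upwards [hae] with s hs ξ hξ
    have hne : ξ + s ≠ 0 := norm_pos_iff.1 (hδ_pos.trans_le (le_norm_add_ofReal hball' hξ hs))
    simpa using ((hasDerivAt_id ξ).add_const (s : ℂ)).fun_inv hne

open Filter Topology Complex in
/-- The Stieltjes transform of `ν` recovers the mass of `ν` at the origin. -/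
theorem tendsto_mul_integral_one_div_add_ofReal {ν : Measure ℝ} [IsFiniteMeasure ν]
    (hν : ν (Set.Iio 0) = 0) :
    Tendsto (fun x : ℝ ↦ (x : ℂ) * ∫ s : ℝ, 1 / ((x : ℂ) + (s : ℂ)) ∂ν) (𝓝[>] 0)
      (𝓝 (ν.real {0} : ℂ)) := by
  have hae : ∀ᵐ s ∂ν, 0 ≤ s := by
    rw [ae_iff]
    simpa [Set.Iio] using hν
  have hlim : ∫ s : ℝ, Set.indicator {0} (fun _ ↦ (1 : ℂ)) s ∂ν = (ν.real {0} : ℂ) := by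
    rw [integral_indicator (measurableSet_singleton 0)]
    simp [measureReal_def]
  simp only [← integral_const_mul]
  rw [← hlim]
  refine tendsto_integral_filter_of_dominated_convergence (fun _ ↦ 1) ?_ ?_
    (integrable_const _) ?_
  · exact Eventually.of_forall fun x ↦ Measurable.aestronglyMeasurable (by fun_prop)
  · filter_upwards [self_mem_nhdsWithin] with x hx
    filter_upwards [hae] with s hs
    have hx : 0 < x := hx
    rw [mul_one_div, ← ofReal_add, ← ofReal_div, norm_real, Real.norm_of_nonneg (by positivity)]
    exact div_le_one_of_le₀ (by linarith) (by positivity)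
  · filter_upwards [hae] with s hs
    rcases hs.eq_or_lt with rfl | hs
    · refine tendsto_const_nhds.congr' ?_
      filter_upwards [self_mem_nhdsWithin] with x hx
      have hx : (x : ℂ) ≠ 0 := ofReal_ne_zero.2 (ne_of_gt hx)
      simp [hx]
    · have hc : ContinuousAt (fun x : ℝ ↦ (x : ℂ) * (1 / ((x : ℂ) + (s : ℂ)))) 0 := by
        refine ContinuousAt.mul (by fun_prop) (ContinuousAt.div (by fun_prop) (by fun_prop) ?_)
        simpa using hs.ne'
      simpa [hs.ne'] using hc.tendsto.mono_left nhdsWithin_le_nhds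

namespace Complex

open scoped ComplexConjugate

variable {ζ : ℂ}

lemma sub_conj_ne_zero {z : ℂ} (hζ : 0 < ζ.im) (hz : 0 ≤ z.im) : z - conj ζ ≠ 0 := fun h0 ↦ by
  have := congrArg im h0
  simp at this
  linarith

/-- The Möbius transformation that maps the unit disc onto the upper half-plane, and `0` to `ζ`. -/
noncomputable def discToHalfPlane (ζ w : ℂ) : ℂ := (ζ - conj ζ * w) / (1 - w)

lemma im_discToHalfPlane (ζ w : ℂ) :
    (discToHalfPlane ζ w).im = ζ.im * (1 - normSq w) / normSq (1 - w) := by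
  rw [discToHalfPlane, div_im, ← sub_div]
  congr 1
  simp [normSq_apply]
  ring

lemma norm_sub_div_sub_conj_lt_one {z : ℂ} (hζ : 0 < ζ.im) (hz : 0 < z.im) :
    ‖(z - ζ) / (z - conj ζ)‖ < 1 := by
  have hne : z - conj ζ ≠ 0 := sub_conj_ne_zero hζ hz.le
  rw [norm_div, div_lt_one (norm_pos_iff.2 hne), ← sq_lt_sq₀ (norm_nonneg _) (norm_nonneg _),
    ← normSq_eq_norm_sq, ← normSq_eq_norm_sq]
  simp [normSq_apply]
  nlinarith [mul_pos hζ hz]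

lemma discToHalfPlane_div {z : ℂ} (hζ : 0 < ζ.im) (hz : z - conj ζ ≠ 0) :
    discToHalfPlane ζ ((z - ζ) / (z - conj ζ)) = z := by
  have h1 : ζ - conj ζ ≠ 0 := sub_conj_ne_zero hζ hζ.le
  have h2 : 1 - (z - ζ) / (z - conj ζ) ≠ 0 := by
    rw [one_sub_div hz]
    refine div_ne_zero ?_ hz
    simpa using h1
  rw [discToHalfPlane, div_eq_iff h2]
  field_simp
  ring

/-- The Herglotz kernel transported to the upper half-plane. -/
lemma I_mul_herglotzRieszKernel_eq {z e : ℂ} (hζ : 0 < ζ.im) (hz : 0 < z.im) (he : ‖e‖ = 1)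
    (he1 : e ≠ 1) :
    I * herglotzRieszKernel 0 ((z - ζ) / (z - conj ζ)) e = (z - ζ.re) / ζ.im -
      (z - ζ) * (z - conj ζ) / ζ.im * (1 / (z + (-(discToHalfPlane ζ e).re : ℝ))) := by
  set x := (discToHalfPlane ζ e).re with hx
  have hxe : discToHalfPlane ζ e = x := by
    refine Complex.ext rfl ?_
    rw [im_discToHalfPlane, normSq_eq_norm_sq, he]
    simp
  have hne : z - conj ζ ≠ 0 := sub_conj_ne_zero hζ hz.le
  have hxne : (x : ℂ) - conj ζ ≠ 0 := sub_conj_ne_zero hζ (ofReal_im x).ge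
  have hzx : z - x ≠ 0 := fun h0 ↦ by
    have := congrArg im h0
    simp at this
    linarith
  have hIm : (ζ.im : ℂ) ≠ 0 := by exact_mod_cast hζ.ne'
  have he_eq : e = (x - ζ) / (x - conj ζ) := by
    rw [discToHalfPlane, div_eq_iff (sub_ne_zero.2 he1.symm)] at hxe
    rw [eq_div_iff hxne]
    linear_combination hxe
  have hconj : conj ζ = ζ.re - ζ.im * I := by
    apply Complex.ext <;> simp
  have hker : herglotzRieszKernel 0 ((z - ζ) / (z - conj ζ)) e =
      ((x - ζ) * (z - conj ζ) + (x - conj ζ) * (z - ζ)) / ((x - z) * (2 * ζ.im * I)) := by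
    have hden : (x - z) * (2 * ζ.im * I) =
        (x - ζ) * (z - conj ζ) - (x - conj ζ) * (z - ζ) := by
      have hsub := sub_conj ζ
      push_cast at hsub
      linear_combination (z - x) * hsub
    rw [hden, herglotzRieszKernel_def, sub_zero, sub_zero, he_eq, div_add_div _ _ hxne hne,
      div_sub_div _ _ hxne hne, div_div_div_cancel_right₀ (mul_ne_zero hxne hne)]
  have algebra (a b x : ℂ) (hb : b ≠ 0) (h₁ : z - x ≠ 0) :
      I * (((x - (a + b * I)) * (z - (a - b * I)) + (x - (a - b * I)) * (z - (a + b * I))) /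
        ((x - z) * (2 * b * I))) =
      (z - a) / b - (z - (a + b * I)) * (z - (a - b * I)) / b * (1 / (z - x)) := by
    have h₂ : x - z ≠ 0 := sub_ne_zero.2 (sub_ne_zero.1 h₁).symm
    have hI := I_ne_zero
    field_simp
    ring
  have key := algebra ζ.re ζ.im x hIm hzx
  rw [re_add_im, ← hconj] at key
  rw [hker, key, ofReal_neg, ← sub_eq_add_neg]

end Complex

open Metric Complex Filter Topology in
open scoped ComplexConjugate in
lemma IsCBF.exists_measure_im_eq {h : ℂ → ℂ} (hh : IsCBF h) {ζ : ℂ} (hζ : 0 < ζ.im) :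
    ∃ ν : Measure ℝ, IsFiniteMeasure ν ∧ ν (Set.Iio 0) = 0 ∧ ∃ α : ℝ, ∀ z : ℂ, 0 < z.im →
      (h z).im = (α * (z - ζ.re) -
        (z - ζ) * (z - conj ζ) / ζ.im * ∫ s : ℝ, 1 / (z + (s : ℂ)) ∂ν).im := by
  obtain ⟨hdiff, hpos, him⟩ := hh
  have hdiffAt {z : ℂ} (hz : z ∈ slitPlane) : DifferentiableAt ℂ h z :=
    hdiff.differentiableAt (isOpen_slitPlane.mem_nhds hz)
  have hmob {w : ℂ} (hw : w ≠ 1) : DifferentiableAt ℂ (discToHalfPlane ζ) w := by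
    have : 1 - w ≠ 0 := sub_ne_zero.2 hw.symm
    unfold discToHalfPlane
    fun_prop (disch := assumption)
  have hmob_im {w : ℂ} (hw : w ∈ ball (0 : ℂ) 1) : 0 < (discToHalfPlane ζ w).im := by
    rw [mem_ball, dist_zero_right] at hw
    have hw1 : 1 - w ≠ 0 := sub_ne_zero.2 fun h1 ↦ by simp [← h1] at hw
    rw [im_discToHalfPlane, normSq_eq_norm_sq w]
    have : 0 < 1 - ‖w‖ ^ 2 := by nlinarith [norm_nonneg w]
    have := normSq_pos.2 hw1
    positivity
  set f : ℂ → ℂ := fun w ↦ -I * h (discToHalfPlane ζ w) with hf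
  have hf_re (w : ℂ) : (f w).re = (h (discToHalfPlane ζ w)).im := by simp [hf]
  have hf_diffAt {w : ℂ} (hw : w ≠ 1) (hw' : discToHalfPlane ζ w ∈ slitPlane) :
      DifferentiableAt ℂ f w :=
    ((hdiffAt hw').comp w (hmob hw)).const_mul (-I)
  obtain ⟨μ, hμ, hμV⟩ := exists_finiteMeasure_re_eq_integral_herglotzRieszKernel (f := f)
    (fun w hw ↦ (hf_diffAt (fun h1 ↦ by simp [h1] at hw)
      (Or.inr (hmob_im hw).ne')).differentiableWithinAt)
    (fun w hw ↦ by rw [hf_re]; exact him _ (hmob_im hw))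
  set A : Set ℝ := {θ | circleMap 0 1 θ ≠ 1} with hA
  have hA_open : IsOpen A := isOpen_ne_fun (continuous_circleMap 0 1) continuous_const
  set σ : ℝ → ℝ := fun θ ↦ -(discToHalfPlane ζ (circleMap 0 1 θ)).re with hσ
  have hσ_meas : Measurable σ := by
    have := (continuous_circleMap 0 1).measurable
    unfold σ discToHalfPlane
    fun_prop
  have hσ_cont : ContinuousOn σ A := fun θ hθ ↦ by
    have := (hmob hθ).continuousAt.comp (f := circleMap 0 1) (continuous_circleMap 0 1).continuousAt
    exact (continuous_re.continuousAt.comp this).neg.continuousWithinAt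
  have hσ_eq (θ : ℝ) : discToHalfPlane ζ (circleMap 0 1 θ) = ((-σ θ : ℝ) : ℂ) := by
    apply Complex.ext
    · simp [hσ]
    · simp [im_discToHalfPlane, normSq_eq_norm_sq]
  refine ⟨((μ : Measure ℝ).restrict A).map σ, inferInstance, ?_,
    (μ : Measure ℝ).real Set.univ / ζ.im, fun z hz ↦ ?_⟩
  · rw [Measure.map_apply hσ_meas measurableSet_Iio,
      Measure.restrict_apply (hσ_meas measurableSet_Iio), Set.inter_comm]
    refine hμV _ (hσ_cont.isOpen_inter_preimage hA_open isOpen_Iio) fun θ ⟨hθ, hσθ⟩ ↦ ?_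
    have hσθ : 0 < -σ θ := neg_pos.2 hσθ
    refine ⟨(hf_diffAt hθ ?_).continuousAt, ?_⟩
    · rw [hσ_eq]
      exact ofReal_mem_slitPlane.2 hσθ
    · rw [hf_re, hσ_eq]
      exact (hpos _ hσθ).1
  · have hne : z - conj ζ ≠ 0 := sub_conj_ne_zero hζ hz.le
    set C : ℂ := (z - ζ) * (z - conj ζ) / ζ.im with hC
    have hw : (z - ζ) / (z - conj ζ) ∈ ball (0 : ℂ) 1 := by
      simpa using norm_sub_div_sub_conj_lt_one hζ hz
    have hbound (s : ℝ) : ‖1 / (z + (s : ℂ))‖ ≤ 1 / z.im := by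
      rw [norm_div, norm_one]
      gcongr
      simpa using (le_abs_self _).trans (abs_im_le_norm (z + s))
    have hint : Integrable (fun θ ↦ A.indicator (fun θ ↦ C * (1 / (z + (σ θ : ℂ)))) θ)
        (μ : Measure ℝ) := by
      refine Integrable.indicator ?_ hA_open.measurableSet
      refine Integrable.const_mul (Integrable.of_bound ?_ (1 / z.im)
        (Eventually.of_forall fun θ ↦ hbound _)) _
      exact Measurable.aestronglyMeasurable (by fun_prop)
    have hkernel (θ : ℝ) :
        (herglotzRieszKernel 0 ((z - ζ) / (z - conj ζ)) (circleMap 0 1 θ)).re =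
          z.im / ζ.im - (A.indicator (fun θ ↦ C * (1 / (z + (σ θ : ℂ)))) θ).im := by
      have hI (k : ℂ) : k.re = (I * k).im := by simp
      have hlin : ((z - ζ.re) / ζ.im : ℂ).im = z.im / ζ.im := by simp [div_ofReal_im]
      by_cases hθ : circleMap 0 1 θ = 1
      · have hζne : (ζ.im : ℂ) ≠ 0 := by exact_mod_cast hζ.ne'
        have : θ ∉ A := fun h1 ↦ h1 hθ
        rw [Set.indicator_of_notMem this, hI, ← hlin, zero_im, sub_zero, hθ]
        congr 1
        have hadd := add_conj ζ
        have hsub := sub_conj ζ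
        push_cast at hadd hsub
        have hden : z - conj ζ - (z - ζ) ≠ 0 := by
          rw [sub_sub_sub_cancel_left, hsub]
          simpa using hζ.ne'
        rw [herglotzRieszKernel_def, sub_zero, sub_zero, one_add_div hne, one_sub_div hne,
          div_div_div_cancel_right₀ hne, ← mul_div_assoc, div_eq_div_iff hden hζne]
        linear_combination (-I * ζ.im) * hadd - (z - ζ.re) * hsub
      · have : θ ∈ A := hθ
        rw [Set.indicator_of_mem this, hI, I_mul_herglotzRieszKernel_eq hζ hz (by simp) hθ, sub_im,
          hlin]
    have hint_im : Integrable (fun θ ↦ (A.indicator (fun θ ↦ C * (1 / (z + (σ θ : ℂ)))) θ).im)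
        (μ : Measure ℝ) := hint.im
    have h1 := hμ _ hw
    rw [hf_re, discToHalfPlane_div hζ hne] at h1
    simp only [hkernel] at h1
    have h2 : ∫ θ, (A.indicator (fun θ ↦ C * (1 / (z + (σ θ : ℂ)))) θ).im ∂(μ : Measure ℝ) =
        (∫ θ, A.indicator (fun θ ↦ C * (1 / (z + (σ θ : ℂ)))) θ ∂(μ : Measure ℝ)).im :=
      integral_im hint
    rw [h1, integral_sub (integrable_const _) hint_im]
    rw [integral_map hσ_meas.aemeasurable (Measurable.aestronglyMeasurable (by fun_prop)),
      ← integral_const_mul, ← integral_indicator hA_open.measurableSet, sub_im, ← h2]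
    congr 1
    rw [integral_const, im_ofReal_mul, sub_im, ofReal_im, sub_zero, smul_eq_mul]
    ring

open Complex Filter Topology in
open scoped ComplexConjugate in
/-- The Nevanlinna representation of a complete Bernstein function, normalised at `ζ`. -/
theorem IsCBF.exists_measure_eq {h : ℂ → ℂ} (hh : IsCBF h) {ζ : ℂ} (hζ : 0 < ζ.im) :
    ∃ ν : Measure ℝ, IsFiniteMeasure ν ∧ ν (Set.Iic 0) = 0 ∧ ∃ α c : ℝ, ∀ z ∈ slitPlane,
      h z = c + α * (z - ζ.re) -
        (z - ζ) * (z - conj ζ) / ζ.im * ∫ s : ℝ, 1 / (z + (s : ℂ)) ∂ν := by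
  obtain ⟨ν, hfin, hν, α, him⟩ := hh.exists_measure_im_eq hζ
  set H : ℂ → ℂ := fun z ↦ α * (z - ζ.re) -
    (z - ζ) * (z - conj ζ) / ζ.im * ∫ s : ℝ, 1 / (z + (s : ℂ)) ∂ν with hH
  have hdiff : DifferentiableOn ℂ (fun z ↦ h z - H z) slitPlane := by
    refine DifferentiableOn.sub hh.1 (DifferentiableOn.sub (by fun_prop) (DifferentiableOn.mul ?_
      (differentiableOn_integral_one_div_add_ofReal hν)))
    fun_prop
  have hana := hdiff.analyticOnNhd isOpen_slitPlane
  set U : Set ℂ := {z | 0 < z.im} with hU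
  have hU_open : IsOpen U := isOpen_lt continuous_const continuous_im
  have hU_conn : IsConnected U :=
    ⟨⟨ζ, hζ⟩, (convex_halfSpace_im_gt 0).isPreconnected⟩
  have hUs : U ⊆ slitPlane := fun z hz ↦ Or.inr (ne_of_gt hz)
  obtain ⟨c, hc⟩ := (hana.mono hUs).eq_const_add_im_mul_I_of_re_eq_const (c₀ := 0)
    (fun z hz ↦ by rw [sub_im, him z hz, sub_self]) hU_open hU_conn
  have heq : Set.EqOn (fun z ↦ h z - H z) (fun _ ↦ (c : ℂ)) slitPlane := by
    refine hana.eqOn_of_preconnected_of_eventuallyEq analyticOnNhd_const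
      (starConvex_one_slitPlane.isPathConnected (by simp)).isConnected.isPreconnected
      (hUs hζ) ?_
    filter_upwards [hU_open.mem_nhds hζ] with z hz
    simpa using hc z hz
  have hrepr : ∀ z ∈ slitPlane, h z = c + α * (z - ζ.re) -
      (z - ζ) * (z - conj ζ) / ζ.im * ∫ s : ℝ, 1 / (z + (s : ℂ)) ∂ν := fun z hz ↦ by
    linear_combination heq hz
  refine ⟨ν, hfin, ?_, α, c, hrepr⟩
  have hlim : Tendsto (fun x : ℝ ↦ ((x : ℂ) * h x).re) (𝓝[>] 0)
      (𝓝 (-(normSq ζ / ζ.im * ν.real {0}))) := by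
    have h1 := tendsto_mul_integral_one_div_add_ofReal hν
    have h2 : Tendsto (fun x : ℝ ↦ (x : ℂ) * (c + α * (x - ζ.re)) -
        (x - ζ) * (x - conj ζ) / ζ.im * (x * ∫ s : ℝ, 1 / ((x : ℂ) + (s : ℂ)) ∂ν)) (𝓝[>] 0)
        (𝓝 (((0 : ℝ) : ℂ) * (c + α * ((0 : ℝ) - ζ.re)) -
          ((0 : ℝ) - ζ) * ((0 : ℝ) - conj ζ) / ζ.im * ν.real {0})) := by
      refine Tendsto.sub ?_ (Tendsto.mul ?_ h1)
      · exact (Continuous.tendsto (by fun_prop) 0).mono_left nhdsWithin_le_nhds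
      · exact (Continuous.tendsto (by fun_prop) 0).mono_left nhdsWithin_le_nhds
    have h3 : ((0 : ℝ) : ℂ) * (c + α * ((0 : ℝ) - ζ.re)) -
        ((0 : ℝ) - ζ) * ((0 : ℝ) - conj ζ) / ζ.im * ν.real {0} =
        ((-(normSq ζ / ζ.im * ν.real {0}) : ℝ) : ℂ) := by
      push_cast
      rw [normSq_eq_conj_mul_self]
      ring
    rw [h3] at h2
    refine ((continuous_re.tendsto _).comp h2).congr' ?_
    filter_upwards [self_mem_nhdsWithin] with x hx
    rw [Function.comp_apply, hrepr x (ofReal_mem_slitPlane.2 hx)]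
    congr 1
    ring
  have hnonneg : 0 ≤ -(normSq ζ / ζ.im * ν.real {0}) := by
    refine ge_of_tendsto hlim ?_
    filter_upwards [self_mem_nhdsWithin] with x hx
    rw [re_ofReal_mul]
    exact mul_nonneg (le_of_lt hx) (hh.2.1 x hx).2
  have hsq : 0 < normSq ζ / ζ.im :=
    div_pos (normSq_pos.2 fun h0 ↦ by simp [h0] at hζ) hζ
  have hzero : ν {0} = 0 := by
    rw [← measureReal_eq_zero_iff]
    nlinarith [measureReal_nonneg (μ := ν) (s := {0})]
  rw [← Set.Iio_union_right]
  exact measure_union_null hν hzero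

/-- For a complete Bernstein function `h` and `Im ζ > 0`, there is a Stieltjes
function `g` with vanishing constants, i.e. `g(ξ) = (1/π)∫ 1/(ξ+s) ν(ds)` for a
measure `ν` on `(0, ∞)` with `∫ min(1, s⁻¹) ν(ds) < ∞`, such that
`h(ξ)/((ξ−ζ)(ξ−conj ζ)) = (1/(2i·Im ζ))(h(ζ)/(ξ−ζ) − h(conj ζ)/(ξ−conj ζ)) − g(ξ)`
on `ℂ ∖ ((−∞,0] ∪ {ζ, conj ζ})`. -/
theorem stmt_12 (h : ℂ → ℂ) (hh : IsCBF h) (ζ : ℂ) (hζ : 0 < ζ.im) :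
    ∃ ν : Measure ℝ,
      ν (Set.Iic 0) = 0 ∧
      (∫⁻ s : ℝ, ENNReal.ofReal (min 1 s⁻¹) ∂ν) < ⊤ ∧
      ∀ ξ : ℂ, (0 < ξ.re ∨ ξ.im ≠ 0) → ξ ≠ ζ → ξ ≠ (starRingEnd ℂ) ζ →
        h ξ / ((ξ - ζ) * (ξ - (starRingEnd ℂ) ζ)) =
          (1 / (2 * Complex.I * (ζ.im : ℂ))) *
              (h ζ / (ξ - ζ) - h ((starRingEnd ℂ) ζ) / (ξ - (starRingEnd ℂ) ζ)) -
            (1 / (Real.pi : ℂ)) * ∫ s : ℝ, 1 / (ξ + (s : ℂ)) ∂ν := by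
  obtain ⟨ν, hfin, hν, α, c, hrepr⟩ := hh.exists_measure_eq hζ
  refine ⟨ENNReal.ofReal (Real.pi / ζ.im) • ν, by simp [hν], ?_, fun ξ hξ hξζ hξζ' ↦ ?_⟩
  · refine lt_of_le_of_lt (lintegral_mono (g := fun _ ↦ 1) fun s ↦ ?_) ?_
    · exact ENNReal.ofReal_le_one.2 (min_le_left _ _)
    · simp [ENNReal.mul_lt_top_iff]
  · have hζne : (ζ.im : ℂ) ≠ 0 := by exact_mod_cast hζ.ne'
    have hpi : (Real.pi : ℂ) ≠ 0 := by exact_mod_cast Real.pi_ne_zero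
    have h1 : ξ - ζ ≠ 0 := sub_ne_zero.2 hξζ
    have h2 : ξ - (starRingEnd ℂ) ζ ≠ 0 := sub_ne_zero.2 hξζ'
    have hval : h ζ = c + α * ζ.im * Complex.I := by
      rw [hrepr ζ (Or.inr hζ.ne')]
      linear_combination (α : ℂ) * (Complex.re_add_im ζ).symm
    have hval' : h ((starRingEnd ℂ) ζ) = c - α * ζ.im * Complex.I := by
      rw [hrepr ((starRingEnd ℂ) ζ) (Or.inr (by simpa using hζ.ne'))]
      have hconj : (starRingEnd ℂ) ζ = ζ.re - ζ.im * Complex.I := by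
        apply Complex.ext <;> simp
      linear_combination (α : ℂ) * hconj
    have hsub := Complex.sub_conj ζ
    have hadd := Complex.add_conj ζ
    push_cast at hsub hadd
    rw [integral_smul_measure, ENNReal.toReal_ofReal (by positivity), hrepr ξ hξ, hval, hval',
      Complex.real_smul, Complex.ofReal_div]
    have hI := Complex.I_ne_zero
    generalize (∫ s : ℝ, 1 / (ξ + (s : ℂ)) ∂ν) = J
    have hsplit : (1 / (2 * Complex.I * (ζ.im : ℂ))) * ((c + α * ζ.im * Complex.I) / (ξ - ζ) -
        (c - α * ζ.im * Complex.I) / (ξ - (starRingEnd ℂ) ζ)) =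
        (c + α * (ξ - ζ.re)) / ((ξ - ζ) * (ξ - (starRingEnd ℂ) ζ)) := by
      rw [div_sub_div _ _ h1 h2, ← mul_div_assoc]
      congr 1
      field_simp
      linear_combination (c : ℂ) * hsub - α * ζ.im * Complex.I * hadd
    rw [hsplit]
    field_simp
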